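/- There exist universal constants c₁ > 0 and c₂ > 0 such that the following holds. For every finite simple graph G = (V, E) with n ≥ 2 vertices and m ≥ 1 edges and every parameter 0 < φ < 1, there exists a cut C ⊆ V satisfying deg_G(C) ≤ m and |E_G(C, V∖C)| < φ·m/(64·(log₂ n)²), and moreover if deg_G(C) ≤ m/100 then G[V∖C] is a (c₁·φ/(log₂ n)^{c₂})-nearly expander in G. -/

import Mathlib

open Finset

variable {V : Type}

/-- The volume `deg_G(S) = ∑_{v ∈ S} deg_G(v)` of a vertex set. -/
def degSum (G : SimpleGraph V) [Fintype V] [DecidableRel G.Adj] (S : Finset V) : ℕ :=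
  ∑ v ∈ S, G.degree v

/-- The number of edges of `G` between the disjoint sets `S` and `T`
(counted as ordered pairs `(s, t)` with `s ∈ S`, `t ∈ T`, `s ~ t`). -/
def interEdges (G : SimpleGraph V) [Fintype V] [DecidableEq V] [DecidableRel G.Adj]
    (S T : Finset V) : ℕ :=
  ((S ×ˢ T).filter fun p => G.Adj p.1 p.2).card

/-- The degree of `v` in the induced subgraph `G[A]`. -/
def indDeg (G : SimpleGraph V) [DecidableEq V] [DecidableRel G.Adj]
    (A : Finset V) (v : V) : ℕ :=
  (A.filter fun u => G.Adj v u).card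

/-- The volume of `S` in the induced subgraph `G[A]`. -/
def indDegSum (G : SimpleGraph V) [DecidableEq V] [DecidableRel G.Adj]
    (A S : Finset V) : ℕ :=
  ∑ v ∈ S, indDeg G A v

/-- The induced subgraph `G[A]` is a `φ`-expander. -/
def IsExpanderOn (G : SimpleGraph V) [Fintype V] [DecidableEq V] [DecidableRel G.Adj]
    (A : Finset V) (φ : ℝ) : Prop :=
  ∀ S ⊆ A,
    φ * min (indDegSum G A S : ℝ) (indDegSum G A (A \ S)) ≤ interEdges G S (A \ S)

/-- `G[A]` is a `φ`-nearly expander in `G`. -/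
def IsNearlyExpanderIn (G : SimpleGraph V) [Fintype V] [DecidableEq V] [DecidableRel G.Adj]
    (A : Finset V) (φ : ℝ) : Prop :=
  ∀ S ⊆ A, (degSum G S : ℝ) ≤ degSum G (A \ S) →
    φ * degSum G S ≤ interEdges G S (Finset.univ \ S)

lemma interEdges_union_le (V : Type) [Fintype V] [DecidableEq V] (G : SimpleGraph V)
    [DecidableRel G.Adj] (C S : Finset V) :
    interEdges G (C ∪ S) (Finset.univ \ (C ∪ S)) ≤
      interEdges G C (Finset.univ \ C) + interEdges G S (Finset.univ \ S) := by
  unfold interEdges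
  refine le_trans (Finset.card_le_card ?_) (Finset.card_union_le _ _)
  intro p hp
  simp only [mem_filter, mem_product, mem_union, mem_sdiff, mem_univ, true_and] at hp ⊢
  tauto

lemma interEdges_compl (V : Type) [Fintype V] [DecidableEq V] (G : SimpleGraph V)
    [DecidableRel G.Adj] (C : Finset V) :
    interEdges G (Finset.univ \ C) (Finset.univ \ (Finset.univ \ C)) =
      interEdges G C (Finset.univ \ C) := by
  unfold interEdges
  refine Finset.card_bij' (fun p _ => p.swap) (fun p _ => p.swap) ?_ ?_ ?_ ?_
  · intro p hp
    simp only [mem_filter, mem_product, mem_sdiff, mem_univ, true_and, not_not, Prod.fst_swap,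
      Prod.snd_swap] at hp ⊢
    exact ⟨⟨hp.1.2, hp.1.1⟩, hp.2.symm⟩
  · intro p hp
    simp only [mem_filter, mem_product, mem_sdiff, mem_univ, true_and, not_not, Prod.fst_swap,
      Prod.snd_swap] at hp ⊢
    exact ⟨⟨hp.1.2, hp.1.1⟩, hp.2.symm⟩
  · intro p _; exact Prod.swap_swap p
  · intro p _; exact Prod.swap_swap p

lemma degSum_add_compl (V : Type) [Fintype V] [DecidableEq V] (G : SimpleGraph V)
    [DecidableRel G.Adj] (C : Finset V) :
    degSum G (Finset.univ \ C) + degSum G C = 2 * G.edgeFinset.card := by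
  unfold degSum
  rw [Finset.sum_sdiff (Finset.subset_univ C)]
  exact G.sum_degrees_eq_twice_card_edges

/-- **Parallel cut-matching** (Theorem 4, existential content): there are universal
constants `c₁, c₂ > 0` such that every graph with `n ≥ 2` vertices, `m ≥ 1` edges and
every `φ ∈ (0,1)` admits a cut `C` with `deg_G(C) ≤ m`,
`|E_G(C, V∖C)| < φ·m/(64·(log₂ n)²)`, and if additionally `deg_G(C) ≤ m/100`, then
`G[V∖C]` is a `(c₁·φ/(log₂ n)^{c₂})`-nearly expander in `G`. -/
theorem parallel_cut_matching :
    ∃ c₁ c₂ : ℝ, 0 < c₁ ∧ 0 < c₂ ∧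
      ∀ (V : Type) [Fintype V] [DecidableEq V] (G : SimpleGraph V) [DecidableRel G.Adj]
        (φ : ℝ), 2 ≤ Fintype.card V → 1 ≤ G.edgeFinset.card → 0 < φ → φ < 1 →
        ∃ C : Finset V,
          degSum G C ≤ G.edgeFinset.card ∧
          (interEdges G C (Finset.univ \ C) : ℝ) <
            φ * G.edgeFinset.card / (64 * Real.logb 2 (Fintype.card V) ^ 2) ∧
          ((degSum G C : ℝ) ≤ (G.edgeFinset.card : ℝ) / 100 →
            IsNearlyExpanderIn G (Finset.univ \ C)
              (c₁ * φ / Real.logb 2 (Fintype.card V) ^ c₂)) := by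
  refine ⟨1 / 256, 2, by norm_num, by norm_num, ?_⟩
  intro V _ _ G _ φ hn hm hφ _
  rw [Real.rpow_two]
  set L := Real.logb 2 (Fintype.card V) with hL
  have hLpos : 0 < L := Real.logb_pos (by norm_num) (by exact_mod_cast hn)
  set ψ : ℝ := 1 / 256 * φ / L ^ 2 with hψ
  have hψpos : 0 < ψ := by positivity
  set m := G.edgeFinset.card with hmdef
  have hm' : (1 : ℝ) ≤ m := by exact_mod_cast hm
  have hτ : φ * m / (64 * L ^ 2) = 4 * (ψ * m) := by
    rw [hψ]; field_simp; norm_num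
  rw [hτ]
  have hψm : 0 < ψ * m := by positivity
  by_cases hbig : ∃ C : Finset V, degSum G C ≤ m ∧
      (interEdges G C (Finset.univ \ C) : ℝ) < 4 * (ψ * m) ∧ (m : ℝ) / 100 < degSum G C
  · obtain ⟨C, h1, h2, h3⟩ := hbig
    exact ⟨C, h1, h2, fun h => absurd h (not_le.mpr h3)⟩
  obtain ⟨C, hC, hmax⟩ := Finset.exists_max_image
    (Finset.univ.filter fun C : Finset V => degSum G C ≤ m ∧
      (interEdges G C (Finset.univ \ C) : ℝ) ≤ ψ * degSum G C) (degSum G)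
    ⟨∅, by simp [degSum, interEdges]⟩
  simp only [mem_filter, mem_univ, true_and] at hC hmax
  obtain ⟨hC1, hC2⟩ := hC
  have hC1' : (degSum G C : ℝ) ≤ m := by exact_mod_cast hC1
  have hCm : ψ * degSum G C ≤ ψ * m := mul_le_mul_of_nonneg_left hC1' hψpos.le
  refine ⟨C, hC1, by linarith, ?_⟩
  intro hsmall S hS hdeg
  by_contra hcon
  push Not at hcon
  have hSpos : 0 < degSum G S := by
    rcases Nat.eq_zero_or_pos (degSum G S) with h | h
    · rw [h] at hcon
      have : (0 : ℝ) ≤ interEdges G S (Finset.univ \ S) := Nat.cast_nonneg _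
      simp only [Nat.cast_zero, mul_zero] at hcon
      linarith
    · exact h
  have hdisj : Disjoint C S := by
    rw [Finset.disjoint_left]
    intro x hx hx'
    exact (Finset.mem_sdiff.mp (hS hx')).2 hx
  have hun : degSum G (C ∪ S) = degSum G C + degSum G S := Finset.sum_union hdisj
  have hun' : (degSum G (C ∪ S) : ℝ) = degSum G C + degSum G S := by exact_mod_cast hun
  have hcut : (interEdges G (C ∪ S) (Finset.univ \ (C ∪ S)) : ℝ) ≤
      interEdges G C (Finset.univ \ C) + interEdges G S (Finset.univ \ S) := by
    exact_mod_cast interEdges_union_le V G C S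
  have hcut2 : (interEdges G (C ∪ S) (Finset.univ \ (C ∪ S)) : ℝ) ≤
      ψ * degSum G (C ∪ S) := by
    rw [hun', mul_add]; linarith
  by_cases hle : degSum G (C ∪ S) ≤ m
  · have := hmax (C ∪ S) ⟨hle, hcut2⟩
    omega
  · have htot := degSum_add_compl V G (C ∪ S)
    rw [← hmdef] at htot
    have htot' : (degSum G (Finset.univ \ (C ∪ S)) : ℝ) + degSum G (C ∪ S) = 2 * m := by
      exact_mod_cast htot
    have hgt : (m : ℝ) < degSum G (C ∪ S) := by exact_mod_cast not_le.mp hle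
    have hnn : (0 : ℝ) ≤ degSum G (Finset.univ \ (C ∪ S)) := Nat.cast_nonneg _
    have h2m : ψ * degSum G (C ∪ S) ≤ ψ * (2 * m) :=
      mul_le_mul_of_nonneg_left (by linarith) hψpos.le
    have hset : (Finset.univ \ C) \ S = Finset.univ \ (C ∪ S) := by
      ext x; simp
    rw [hset] at hdeg
    refine hbig ⟨Finset.univ \ (C ∪ S), by omega, ?_, by linarith⟩
    rw [interEdges_compl]
    linarith
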